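/- Let A be a Q(q)-algebra, B_i, B_j ∈ A, and Z a central element of A, with ı-divided powers B^{(m)}_{i,p̄} of B_i defined with parameter Z. Suppose a_{ij} = −2 and the degree-3 identity B_i³ B_j − [3]_q B_i² B_j B_i + [3]_q B_i B_j B_i² − B_j B_i³ = [2]_q² q Z (B_i B_j − B_j B_i) holds. Then for both parities p̄ ∈ Z/2: ∑_{r+s=5} (−1)^r B^{(r)}_{i,p̄} B_j B^{(s)}_{i,p̄} = 0. -/

import Mathlib

noncomputable section

abbrev K : Type := RatFunc ℚ

/-- The indeterminate `q` in `ℚ(q)`. -/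
def qq : K := RatFunc.X

/-- Balanced quantum integer at base `x`. -/
def qintx (x : K) (m : ℤ) : K := (x ^ m - x ^ (-m)) / (x - x⁻¹)

/-- Balanced quantum integer `[m]_q`. -/
def qint (m : ℤ) : K := qintx qq m

/-- Quantum factorial at base `x`. -/
def qfactx (x : K) (m : ℕ) : K := ∏ j ∈ Finset.range m, qintx x ((j : ℤ) + 1)

/-- Quantum factorial `[m]_q!`. -/
def qfact (m : ℕ) : K := qfactx qq m

/-- Gaussian binomial coefficient at base `x` (zero when `r > m`). -/
def qbinomx (x : K) (m r : ℕ) : K :=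
  if r ≤ m then qfactx x m / (qfactx x r * qfactx x (m - r)) else 0

/-- Gaussian binomial coefficient. -/
def qbinom (m r : ℕ) : K := qbinomx qq m r

/-- The ı-divided powers `B^{(m)}_{p̄}` of `B` with central parameter `Z`,
given by the closed product formulas of the paper. -/
def iDP {A : Type*} [Ring A] [Algebra K A] (B Z : A) (p : ZMod 2) (m : ℕ) : A :=
  (qfact m)⁻¹ •
    ((if m % 2 = 1 then B else 1) *
      ((List.range (m / 2)).map (fun j =>
        B ^ 2 -
          ((qint (if p = 1 then 2 * (j : ℤ) + 1
                  else if m % 2 = 1 then 2 * (j : ℤ) + 2 else 2 * (j : ℤ))) ^ 2 * qq) • Z)).prod)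

/-- The usual divided power `x^{(k)} = x^k/[k]_q!`. -/
def dp {A : Type*} [Ring A] [Algebra K A] (x : A) (k : ℕ) : A := (qfact k)⁻¹ • x ^ k

theorem qq_ne_zero : qq ≠ 0 := RatFunc.X_ne_zero

theorem qq_pow_ne_one {m : ℕ} (hm : m ≠ 0) : qq ^ m ≠ 1 := by
  intro h
  have hX : (Polynomial.X ^ m : Polynomial ℚ) = 1 := by
    apply RatFunc.algebraMap_injective ℚ
    rw [map_pow, RatFunc.algebraMap_X, map_one]
    exact h
  simpa [hm] using congrArg Polynomial.natDegree hX

theorem qq_sub_inv_ne_zero : qq - qq⁻¹ ≠ 0 := by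
  intro h
  apply qq_pow_ne_one two_ne_zero
  have hq := qq_ne_zero
  field_simp at h
  linear_combination h

theorem qint_natCast_ne_zero {m : ℕ} (hm : m ≠ 0) : qint m ≠ 0 := by
  refine div_ne_zero (fun h => ?_) qq_sub_inv_ne_zero
  apply qq_pow_ne_one (mul_ne_zero two_ne_zero hm)
  have hq : qq ^ m ≠ 0 := pow_ne_zero m qq_ne_zero
  rw [zpow_neg, zpow_natCast, sub_eq_zero] at h
  rw [two_mul, pow_add]
  exact (eq_mul_inv_iff_mul_eq₀ hq).mp (by rwa [one_mul])

theorem qint_zero : qint 0 = 0 := by simp [qint, qintx]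

theorem qint_one : qint 1 = 1 := by
  simp [qint, qintx, div_self qq_sub_inv_ne_zero]

theorem qint_add_two (m : ℤ) : qint (m + 2) = qint 2 * qint (m + 1) - qint m := by
  have hq := qq_ne_zero
  have hd := qq_sub_inv_ne_zero
  have hm : qq ^ m ≠ 0 := zpow_ne_zero m hq
  have h2 : qint 2 = qq + qq⁻¹ := by
    rw [qint, qintx, div_eq_iff hd, zpow_neg]
    norm_cast
    field_simp
    ring
  rw [h2]
  simp only [qint, qintx]
  rw [mul_div_assoc', ← sub_div]
  congr 1
  simp only [zpow_neg, zpow_add₀ hq, zpow_ofNat]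
  field_simp
  ring

theorem qint_three : qint 3 = qint 2 ^ 2 - 1 := by
  have := qint_add_two 1
  norm_num [qint_one] at this
  linear_combination this

theorem qint_four : qint 4 = qint 2 ^ 3 - 2 * qint 2 := by
  have := qint_add_two 2
  norm_num [qint_three] at this
  linear_combination this

theorem qint_five : qint 5 = qint 2 ^ 4 - 3 * qint 2 ^ 2 + 1 := by
  have := qint_add_two 3
  norm_num [qint_three, qint_four] at this
  linear_combination this

theorem qfact_succ (m : ℕ) : qfact (m + 1) = qfact m * qint (m + 1) :=
  Finset.prod_range_succ _ m

/-- The degree-five relation for elements `D m` built like the ı-divided powers of `B` of either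
parity, over an arbitrary field; `t`, `c₃`, `c₄`, `c₅` play the roles of `[2]`, `[3]`, `[4]`, `[5]`
and the pairs of alternatives for `a`, `b`, `c`, `d` are the two parities. -/
theorem sum_neg_one_pow_smul_mul_mul_eq_zero {F A : Type*} [Field F] [Ring A] [Algebra F A]
    {B C Z : A} {q t c₃ c₄ c₅ a b c d : F} (ht : t ≠ 0) (h₃ : c₃ ≠ 0) (h₄ : c₄ ≠ 0) (h₅ : c₅ ≠ 0)
    (hc₃ : c₃ = t ^ 2 - 1) (hc₄ : c₄ = t ^ 3 - 2 * t) (hc₅ : c₅ = t ^ 4 - 3 * t ^ 2 + 1)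
    (hZ : ∀ x : A, Z * x = x * Z)
    (h : B ^ 3 * C - c₃ • (B ^ 2 * C * B) + c₃ • (B * C * B ^ 2) - C * B ^ 3 =
      (t ^ 2 * q) • (Z * (B * C - C * B)))
    (habcd : (a = 0 ∧ b = t ∧ c = t ∧ d = c₄) ∨ (a = 1 ∧ b = 1 ∧ c = c₃ ∧ d = c₃))
    {D : ℕ → A} (hD₀ : D 0 = 1) (hD₁ : D 1 = B)
    (hD₂ : D 2 = t⁻¹ • (B ^ 2 - (a ^ 2 * q) • Z))
    (hD₃ : D 3 = (t * c₃)⁻¹ • (B * (B ^ 2 - (b ^ 2 * q) • Z)))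
    (hD₄ : D 4 = (t * c₃ * c₄)⁻¹ • ((B ^ 2 - (a ^ 2 * q) • Z) * (B ^ 2 - (c ^ 2 * q) • Z)))
    (hD₅ : D 5 = (t * c₃ * c₄ * c₅)⁻¹ •
      (B * ((B ^ 2 - (b ^ 2 * q) • Z) * (B ^ 2 - (d ^ 2 * q) • Z)))) :
    ∑ r ∈ Finset.range 6, ((-1 : F) ^ r) • (D r * C * D (5 - r)) = 0 := by
  have hBZ : B * Z = Z * B := (hZ B).symm
  have hCZ : C * Z = Z * C := (hZ C).symm
  have hBZ' (x : A) : B * (Z * x) = Z * (B * x) := by rw [← mul_assoc, hBZ, mul_assoc]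
  have hCZ' (x : A) : C * (Z * x) = Z * (C * x) := by rw [← mul_assoc, hCZ, mul_assoc]
  have hl := congrArg (fun x => B * (B * x)) h
  have hm := congrArg (fun x => B * (x * B)) h
  have hr := congrArg (fun x => x * (B * B)) h
  have hz := congrArg (fun x => Z * x) h
  simp only [pow_succ, pow_zero, one_mul, mul_assoc, mul_sub, mul_add, sub_mul, add_mul,
    smul_mul_assoc, mul_smul_comm, hBZ'] at hl hm hr hz
  simp only [Finset.sum_range_succ, Finset.sum_range_zero, Nat.reduceSub, hD₀, hD₁, hD₂, hD₃, hD₄,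
    hD₅, pow_succ, pow_zero, one_mul, mul_one, mul_assoc, mul_sub, sub_mul,
    smul_mul_assoc, mul_smul_comm, hBZ, hCZ, hBZ', hCZ']
  linear_combination (norm := skip) (-(t * c₃ * c₄ * c₅)⁻¹) •
    (hl - (t ^ 4 - 4 * t ^ 2 + 2) • hm + hr - (c₄ ^ 2 * q) • hz)
  rcases habcd with ⟨rfl, rfl, rfl, rfl⟩ | ⟨rfl, rfl, rfl, rfl⟩ <;>
    match_scalars <;> field_simp <;> simp only [hc₃, hc₄, hc₅] <;> ring

theorem stmt9 {A : Type*} [Ring A] [Algebra K A] (Bi Bj Z : A)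
    (hZ : ∀ a : A, Z * a = a * Z)
    (h : Bi ^ 3 * Bj - qint 3 • (Bi ^ 2 * Bj * Bi) + qint 3 • (Bi * Bj * Bi ^ 2) - Bj * Bi ^ 3 =
      ((qint 2) ^ 2 * qq) • (Z * (Bi * Bj - Bj * Bi))) :
    ∀ p : ZMod 2, ∑ r ∈ Finset.range 6,
        ((-1 : K) ^ r) • (iDP Bi Z p r * Bj * iDP Bi Z p (5 - r)) = 0 := by
  have h₂ : qint 2 ≠ 0 := mod_cast qint_natCast_ne_zero two_ne_zero
  have h₃ : qint 3 ≠ 0 := mod_cast qint_natCast_ne_zero three_ne_zero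
  have h₄ : qint 4 ≠ 0 := mod_cast qint_natCast_ne_zero four_ne_zero
  have h₅ : qint 5 ≠ 0 := mod_cast qint_natCast_ne_zero (m := 5) (by norm_num)
  have f₀ : qfact 0 = 1 := by simp [qfact, qfactx]
  have f₁ : qfact 1 = 1 := by rw [qfact_succ, f₀]; norm_num [qint_one]
  have f₂ : qfact 2 = qint 2 := by rw [qfact_succ, f₁]; norm_num
  have f₃ : qfact 3 = qint 2 * qint 3 := by rw [qfact_succ, f₂]; norm_num
  have f₄ : qfact 4 = qint 2 * qint 3 * qint 4 := by rw [qfact_succ, f₃]; norm_num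
  have f₅ : qfact 5 = qint 2 * qint 3 * qint 4 * qint 5 := by rw [qfact_succ, f₄]; norm_num
  intro p
  have hp : p = 0 ∨ p = 1 := by revert p; decide
  rcases hp with rfl | rfl
  · refine sum_neg_one_pow_smul_mul_mul_eq_zero h₂ h₃ h₄ h₅ qint_three qint_four qint_five hZ h
      (Or.inl ⟨rfl, rfl, rfl, rfl⟩) ?_ ?_ ?_ ?_ ?_ ?_ <;>
    simp [iDP, List.range_succ, f₀, f₁, f₂, f₃, f₄, f₅, qint_zero]
  · refine sum_neg_one_pow_smul_mul_mul_eq_zero h₂ h₃ h₄ h₅ qint_three qint_four qint_five hZ h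
      (Or.inr ⟨rfl, rfl, rfl, rfl⟩) ?_ ?_ ?_ ?_ ?_ ?_ <;>
    simp [iDP, List.range_succ, f₀, f₁, f₂, f₃, f₄, f₅, qint_one]
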